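/- arXiv:math/9911107 — 2 statements merged into one kernel-verified Lean document; each statement's English description precedes it below -/
import Mathlib

section
/- Let ψ : F₂ → Aut(ℤ²) be the group homomorphism from the free group on two generators a, b to the automorphism group of ℤ² determined by ψ(a) = id and ψ(b) = the automorphism of ℤ² given by the matrix [[2,1],[1,1]] (i.e. (x,y) ↦ (2x+y, x+y)). Then the center of the semidirect product ℤ² ⋊_ψ F₂ is trivial. -/
/-- The automorphism of `ℤ²` given by the matrix `[[2,1],[1,1]]`,
i.e. `(x, y) ↦ (2x + y, x + y)`. -/
def matAut : (ℤ × ℤ) ≃+ (ℤ × ℤ) where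
  toFun p := (2 * p.1 + p.2, p.1 + p.2)
  invFun p := (p.1 - p.2, -p.1 + 2 * p.2)
  left_inv p := by ext <;> simp <;> ring
  right_inv p := by ext <;> simp <;> ring
  map_add' p q := by ext <;> simp <;> ring

/-- An element of the free group on two generators commuting with both is trivial. -/
theorem free_center_aux (g : FreeGroup (Fin 2))
    (h : ∀ i : Fin 2, FreeGroup.of i * g = g * FreeGroup.of i) : g = 1 := by
  rw [← FreeGroup.toWord_eq_nil_iff]
  rcases hL : g.toWord with _ | ⟨p, L⟩
  · rfl
  exfalso
  obtain ⟨i, hi⟩ : ∃ i : Fin 2, i ≠ p.1 := exists_ne p.1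
  have h1 : (FreeGroup.of i * g).toWord = (i, true) :: p :: L := by
    have hr : FreeGroup.reduce (p :: L) = p :: L := by
      rw [← hL, FreeGroup.reduce_toWord]
    rw [FreeGroup.toWord_mul, FreeGroup.toWord_of, hL, List.singleton_append,
      FreeGroup.reduce.cons, hr]
    simp [hi]
  have h2 : (g * FreeGroup.of i).toWord = FreeGroup.reduce ((p :: L) ++ [(i, true)]) := by
    rw [FreeGroup.toWord_mul, FreeGroup.toWord_of, hL]
  have h3 : FreeGroup.reduce ((p :: L) ++ [(i, true)]) = (i, true) :: p :: L := by
    rw [← h2, ← h i, h1]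
  have h4 : List.Sublist ((i, true) :: p :: L) ((p :: L) ++ [(i, true)]) := by
    rw [← h3]
    exact FreeGroup.Red.sublist FreeGroup.reduce.red
  have h5 := h4.eq_of_length (by simp)
  simp only [List.cons_append, List.cons.injEq] at h5
  exact hi (by rw [← h5.1])

/-- If `ψ : F₂ → Aut(ℤ²)` sends the first generator `a` to the identity and the
second generator `b` to the automorphism given by the matrix `[[2,1],[1,1]]`,
then the center of the semidirect product `ℤ² ⋊_ψ F₂` is trivial. -/
theorem center_semidirect_trivial
    (ψ : FreeGroup (Fin 2) →* MulAut (Multiplicative (ℤ × ℤ)))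
    (ha : ψ (FreeGroup.of 0) = 1)
    (hb : ψ (FreeGroup.of 1) = AddEquiv.toMultiplicative matAut) :
    Subgroup.center (Multiplicative (ℤ × ℤ) ⋊[ψ] FreeGroup (Fin 2)) = ⊥ := by
  rw [eq_bot_iff]
  intro z hz
  rw [Subgroup.mem_center_iff] at hz
  have hr : z.right = 1 := by
    apply free_center_aux
    intro i
    have := congrArg SemidirectProduct.right (hz (SemidirectProduct.inr (FreeGroup.of i)))
    simpa using this
  have hl := congrArg SemidirectProduct.left (hz (SemidirectProduct.inr (FreeGroup.of 1)))
  simp only [SemidirectProduct.mul_left, SemidirectProduct.left_inr,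
    SemidirectProduct.right_inr, hr, hb, map_one, one_mul, mul_one] at hl
  have hm : matAut (Multiplicative.toAdd z.left) = Multiplicative.toAdd z.left := hl
  have hx : z.left = 1 := by
    have e1 : 2 * (Multiplicative.toAdd z.left).1 + (Multiplicative.toAdd z.left).2
        = (Multiplicative.toAdd z.left).1 := congrArg Prod.fst hm
    have e2 : (Multiplicative.toAdd z.left).1 + (Multiplicative.toAdd z.left).2
        = (Multiplicative.toAdd z.left).2 := congrArg Prod.snd hm
    apply Multiplicative.toAdd.injective
    apply Prod.ext
    · change (Multiplicative.toAdd z.left).1 = 0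
      omega
    · change (Multiplicative.toAdd z.left).2 = 0
      omega
  rw [Subgroup.mem_bot]
  exact SemidirectProduct.ext hx hr
end

section
/- Let ψ : F₂ → Aut(ℤ²) be the group homomorphism from the free group on two generators a, b determined by ψ(a) = id and ψ(b) = the automorphism of ℤ² given by the matrix [[2,1],[1,1]]. Then the map ℤ³ → ℤ² ⋊_ψ F₂ sending (k, l, m) to the element with ℤ²-component (l, m) and F₂-component (a b a⁻¹ b⁻¹)^k is an injective group homomorphism. -/
/-- Let `ψ : F₂ → Aut(ℤ²)` send the first generator `a` to the identity and the
second generator `b` to the automorphism given by the matrix `[[2,1],[1,1]]`.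
Then the map `ℤ³ → ℤ² ⋊_ψ F₂`, `(k, l, m) ↦ ((l, m), (a b a⁻¹ b⁻¹)^k)`,
is an injective group homomorphism. -/
theorem exists_injective_hom_of_three_torus
    (ψ : FreeGroup (Fin 2) →* MulAut (Multiplicative (ℤ × ℤ)))
    (ha : ψ (FreeGroup.of 0) = 1)
    (hb : ψ (FreeGroup.of 1) = AddEquiv.toMultiplicative matAut) :
    ∃ f : Multiplicative (ℤ × ℤ × ℤ) →*
        Multiplicative (ℤ × ℤ) ⋊[ψ] FreeGroup (Fin 2),
      Function.Injective f ∧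
      ∀ k l m : ℤ,
        f (Multiplicative.ofAdd (k, l, m)) =
          ⟨Multiplicative.ofAdd (l, m),
           (FreeGroup.of 0 * FreeGroup.of 1 *
            (FreeGroup.of 0)⁻¹ * (FreeGroup.of 1)⁻¹) ^ k⟩ := by
  set c : FreeGroup (Fin 2) := FreeGroup.of 0 * FreeGroup.of 1 *
            (FreeGroup.of 0)⁻¹ * (FreeGroup.of 1)⁻¹ with hc
  have hψc : ψ c = 1 := by
    simp [hc, ha]
  have hc1 : c ≠ 1 := by
    rw [hc]
    decide
  have hinj : Function.Injective (fun k : ℤ => c ^ k) :=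
    injective_zpow_iff_not_isOfFinOrder.2 (not_isOfFinOrder_of_isMulTorsionFree hc1)
  refine ⟨MonoidHom.mk' (fun x => ⟨Multiplicative.ofAdd (Multiplicative.toAdd x).2,
    c ^ (Multiplicative.toAdd x).1⟩) ?_, ?_, ?_⟩
  · intro x y
    apply SemidirectProduct.ext
    · change Multiplicative.ofAdd (Multiplicative.toAdd x).2 *
          Multiplicative.ofAdd (Multiplicative.toAdd y).2 =
        Multiplicative.ofAdd (Multiplicative.toAdd x).2 *
          ψ (c ^ (Multiplicative.toAdd x).1) (Multiplicative.ofAdd (Multiplicative.toAdd y).2)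
      rw [map_zpow, hψc, one_zpow]
      rfl
    · exact zpow_add c _ _
  · intro x y h
    have h1 := congrArg SemidirectProduct.left h
    have h2 := congrArg SemidirectProduct.right h
    apply Multiplicative.toAdd.injective
    exact Prod.ext (hinj h2) (Multiplicative.ofAdd.injective h1)
  · intro k l m
    rfl
end
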